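/- For every u > 0, the one-dimensional projection inf_{v>0} I(u,v) equals 2·J_BS(u), where J_BS is given explicitly by: J_BS(u) = ξ²/2 − ξ·tanh(ξ/2) for u > 1, where ξ > 0 is the unique positive solution of sinh(ξ)/ξ = u; J_BS(u) = 2λ·(tan λ − λ) for 0 < u < 1, where λ ∈ (0, π/2) is the unique solution of sin(2λ)/(2λ) = u; and J_BS(1) = 0. -/

import Mathlib

open MeasureTheory ProbabilityTheory Filter Real

/-- The variational rate function `I(u,v)`: infimum of `4∫₀¹ f'(z)² dz` over absolutely
continuous `f : [0,1] → ℝ` (written as `f(z) = ∫₀ᶻ g`) with square-integrable derivative `g`,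
`f(0) = 0`, `∫₀¹ e^{2 f(z)} dz = u` and `e^{f(1)} = v`. -/
noncomputable def ratefun (u v : ℝ) : ℝ :=
  sInf {r : ℝ | ∃ g : ℝ → ℝ,
    IntervalIntegrable g volume 0 1 ∧
    IntervalIntegrable (fun z => (g z) ^ 2) volume 0 1 ∧
    (∫ z in (0:ℝ)..(1:ℝ), Real.exp (2 * ∫ t in (0:ℝ)..z, g t)) = u ∧
    Real.exp (∫ t in (0:ℝ)..(1:ℝ), g t) = v ∧
    r = 4 * ∫ z in (0:ℝ)..(1:ℝ), (g z) ^ 2}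


/-- Integration by parts against a tail integral. -/
lemma integral_mul_tail_eq {g h : ℝ → ℝ} (hg : IntervalIntegrable g volume 0 1)
    (hh : IntervalIntegrable h volume 0 1) :
    ∫ z in (0:ℝ)..1, g z * ∫ t in z..1, h t = ∫ z in (0:ℝ)..1, (∫ t in (0:ℝ)..z, g t) * h z := by
  have hF := hg.absolutelyContinuousOnInterval_intervalIntegral (c := 0) (by simp)
  have hH := hh.absolutelyContinuousOnInterval_intervalIntegral (c := 1) (by simp)
  have key := hF.integral_mul_deriv_eq_deriv_mul hH
  have e1 : ∫ z in (0:ℝ)..1, (∫ t in (0:ℝ)..z, g t) * deriv (fun x => ∫ t in (1:ℝ)..x, h t) z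
      = ∫ z in (0:ℝ)..1, (∫ t in (0:ℝ)..z, g t) * h z := by
    apply intervalIntegral.integral_congr_ae
    filter_upwards [hh.ae_hasDerivAt_integral] with x hx hx'
    rw [(hx (Set.uIoc_subset_uIcc hx') 1 (by simp)).deriv]
  have e2 : ∫ z in (0:ℝ)..1, deriv (fun x => ∫ t in (0:ℝ)..x, g t) z * (∫ t in (1:ℝ)..z, h t)
      = -∫ z in (0:ℝ)..1, g z * ∫ t in z..1, h t := by
    rw [← intervalIntegral.integral_neg]
    apply intervalIntegral.integral_congr_ae
    filter_upwards [hg.ae_hasDerivAt_integral] with x hx hx'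
    rw [(hx (Set.uIoc_subset_uIcc hx') 0 (by simp)).deriv, intervalIntegral.integral_symm x 1]
    ring
  rw [e1, e2] at key
  simpa using key.symm

/-- Endpoint and exponential moment of a path can be prescribed independently. -/
lemma exists_path_with_endpoint {u : ℝ} (hu : 0 < u) (c : ℝ) :
    ∃ g : ℝ → ℝ, Continuous g ∧
      (∫ z in (0:ℝ)..1, exp (2 * ∫ t in (0:ℝ)..z, g t)) = u ∧ ∫ t in (0:ℝ)..1, g t = c := by
  have hprim : ∀ s z : ℝ, ∫ t in (0:ℝ)..z, (c + s * (1 - 2 * t)) = c * z + s * (z * (1 - z)) := by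
    intro s z
    have : ∀ x ∈ Set.uIcc 0 z, HasDerivAt (fun z => c * z + s * (z * (1 - z)))
        (c + s * (1 - 2 * x)) x := by
      intro x _
      have h := ((hasDerivAt_id x).const_mul c).add
        (((hasDerivAt_id x).mul ((hasDerivAt_id x).const_sub 1)).const_mul s)
      convert! h using 1
      simp only [id]; ring
    rw [intervalIntegral.integral_eq_sub_of_hasDerivAt this
      (Continuous.intervalIntegrable (by fun_prop) _ _)]
    simp
  let Φ : ℝ → ℝ := fun s => ∫ z in (0:ℝ)..1, exp (2 * (c * z + s * (z * (1 - z))))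
  have hΦ : Continuous Φ := by
    apply intervalIntegral.continuous_parametric_intervalIntegral_of_continuous'
    fun_prop
  have htop : Tendsto Φ atTop atTop := by
    have hlin : Tendsto (fun s : ℝ => 1 + c + s / 3) atTop atTop :=
      tendsto_atTop_add_const_left _ _ (tendsto_id.atTop_div_const (by norm_num))
    refine tendsto_atTop_mono (fun s => ?_) hlin
    have e : ∫ z in (0:ℝ)..1, (2 * (c * z + s * (z * (1 - z))) + 1) = 1 + c + s / 3 := by
      have : ∀ x ∈ Set.uIcc (0:ℝ) 1,
          HasDerivAt (fun z => c * z ^ 2 + s * (z ^ 2 - 2 / 3 * z ^ 3) + z)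
          (2 * (c * x + s * (x * (1 - x))) + 1) x := by
        intro x _
        have h := (((hasDerivAt_pow 2 x).const_mul c).add
          (((hasDerivAt_pow 2 x).sub ((hasDerivAt_pow 3 x).const_mul (2 / 3))).const_mul s)).add
          (hasDerivAt_id x)
        convert! h using 1
        simp; ring
      rw [intervalIntegral.integral_eq_sub_of_hasDerivAt this
        (Continuous.intervalIntegrable (by fun_prop) _ _)]
      ring
    rw [← e]
    apply intervalIntegral.integral_mono_on zero_le_one
    · exact Continuous.intervalIntegrable (by fun_prop) _ _
    · exact Continuous.intervalIntegrable (by fun_prop) _ _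
    · intro x _
      exact add_one_le_exp _
  have hbot : Tendsto Φ atBot (nhds 0) := by
    have h0 : (0:ℝ) = ∫ z in (0:ℝ)..1, (0:ℝ) := by simp
    rw [h0]
    apply intervalIntegral.tendsto_integral_filter_of_dominated_convergence
      (fun z => exp (2 * (c * z)))
    · exact Eventually.of_forall fun s => Continuous.aestronglyMeasurable (by fun_prop)
    · filter_upwards [eventually_le_atBot (0:ℝ)] with s hs
      refine Eventually.of_forall fun z hz => ?_
      rw [Set.uIoc_of_le zero_le_one] at hz
      rw [norm_of_nonneg (exp_pos _).le, exp_le_exp]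
      have := mul_nonneg hz.1.le (sub_nonneg.2 hz.2)
      nlinarith
    · exact Continuous.intervalIntegrable (by fun_prop) _ _
    · filter_upwards [compl_mem_ae_iff.2 (measure_singleton (1:ℝ))] with z hz1 hz
      rw [Set.uIoc_of_le zero_le_one] at hz
      have hz1' : z < 1 := lt_of_le_of_ne hz.2 hz1
      have hp : 0 < z * (1 - z) := mul_pos hz.1 (sub_pos.2 hz1')
      refine tendsto_exp_atBot.comp (Tendsto.const_mul_atBot two_pos ?_)
      exact tendsto_atBot_add_const_left _ _ (tendsto_id.atBot_mul_const hp)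
  obtain ⟨s, hs⟩ : ∃ s, Φ s = u := by
    obtain ⟨s₁, h₁⟩ := (hbot.eventually (eventually_le_nhds hu)).exists
    obtain ⟨s₂, h₂⟩ := (htop.eventually_ge_atTop u).exists
    exact mem_range_of_exists_le_of_exists_ge hΦ ⟨s₁, h₁⟩ ⟨s₂, h₂⟩
  refine ⟨fun t => c + s * (1 - 2 * t), by fun_prop, ?_, ?_⟩
  · simp_rw [hprim]
    exact hs
  · rw [hprim]; ring

lemma sInf_ratefun_eq {u : ℝ} (hu : 0 < u) {g₀ : ℝ → ℝ}
    (h₁ : IntervalIntegrable g₀ volume 0 1)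
    (h₂ : IntervalIntegrable (fun z => g₀ z ^ 2) volume 0 1)
    (h₃ : ∫ z in (0:ℝ)..1, exp (2 * ∫ t in (0:ℝ)..z, g₀ t) = u)
    (hmin : ∀ g : ℝ → ℝ, IntervalIntegrable g volume 0 1 →
      IntervalIntegrable (fun z => g z ^ 2) volume 0 1 →
      ∫ z in (0:ℝ)..1, exp (2 * ∫ t in (0:ℝ)..z, g t) = u →
      ∫ z in (0:ℝ)..1, g₀ z ^ 2 ≤ ∫ z in (0:ℝ)..1, g z ^ 2) :
    sInf {r : ℝ | ∃ v : ℝ, 0 < v ∧ r = ratefun u v} = 4 * ∫ z in (0:ℝ)..1, g₀ z ^ 2 := by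
  have hlow : ∀ v : ℝ, 0 < v → 4 * ∫ z in (0:ℝ)..1, g₀ z ^ 2 ≤ ratefun u v := by
    intro v hv
    apply le_csInf
    · obtain ⟨g, hg, hgu, hgv⟩ := exists_path_with_endpoint hu (log v)
      exact ⟨_, g, hg.intervalIntegrable _ _, (hg.pow 2).intervalIntegrable _ _, hgu,
        by rw [hgv, exp_log hv], rfl⟩
    · rintro r ⟨g, hg, hg2, hgu, -, rfl⟩
      have := hmin g hg hg2 hgu
      linarith
  apply le_antisymm
  · refine le_trans (b := ratefun u (exp (∫ t in (0:ℝ)..1, g₀ t)))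
      (csInf_le ⟨4 * ∫ z in (0:ℝ)..1, g₀ z ^ 2, ?_⟩ ⟨_, exp_pos _, rfl⟩)
      (csInf_le ⟨0, ?_⟩ ⟨g₀, h₁, h₂, h₃, rfl, rfl⟩)
    · rintro r ⟨v, hv, rfl⟩
      exact hlow v hv
    · rintro r ⟨g, -, -, -, -, rfl⟩
      exact mul_nonneg (by norm_num)
        (intervalIntegral.integral_nonneg zero_le_one fun z _ => sq_nonneg _)
  · refine le_csInf ⟨ratefun u 1, 1, one_pos, rfl⟩ ?_
    rintro r ⟨v, hv, rfl⟩
    exact hlow v hv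

/-- Convex case: a path solving the Euler–Lagrange equation with nonpositive multiplier is a
minimizer. -/
lemma integral_sq_le_of_euler_lagrange {g₀ g : ℝ → ℝ} {K : ℝ} (hK : 0 ≤ K)
    (h₁ : IntervalIntegrable g₀ volume 0 1)
    (h₂ : IntervalIntegrable (fun z => g₀ z ^ 2) volume 0 1)
    (hEL : ∀ z ∈ Set.Icc (0:ℝ) 1,
      g₀ z = -K * ∫ t in z..1, exp (2 * ∫ s in (0:ℝ)..t, g₀ s))
    (hg : IntervalIntegrable g volume 0 1)
    (hg2 : IntervalIntegrable (fun z => g z ^ 2) volume 0 1)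
    (heq : ∫ z in (0:ℝ)..1, exp (2 * ∫ t in (0:ℝ)..z, g t) =
      ∫ z in (0:ℝ)..1, exp (2 * ∫ t in (0:ℝ)..z, g₀ t)) :
    ∫ z in (0:ℝ)..1, g₀ z ^ 2 ≤ ∫ z in (0:ℝ)..1, g z ^ 2 := by
  have hF := (hg.absolutelyContinuousOnInterval_intervalIntegral (c := 0) (by simp)).continuousOn
  have hF₀ := (h₁.absolutelyContinuousOnInterval_intervalIntegral (c := 0) (by simp)).continuousOn
  set F : ℝ → ℝ := fun z => ∫ t in (0:ℝ)..z, g t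
  set F₀ : ℝ → ℝ := fun z => ∫ t in (0:ℝ)..z, g₀ t
  have hE : ContinuousOn (fun z => exp (2 * F z)) (Set.uIcc 0 1) := by fun_prop
  have hE₀ : ContinuousOn (fun z => exp (2 * F₀ z)) (Set.uIcc 0 1) := by fun_prop
  have hpair : ∀ f : ℝ → ℝ, IntervalIntegrable f volume 0 1 →
      ∫ z in (0:ℝ)..1, f z * g₀ z =
        -K * ∫ z in (0:ℝ)..1, (∫ t in (0:ℝ)..z, f t) * exp (2 * F₀ z) := by
    intro f hf
    rw [← integral_mul_tail_eq hf hE₀.intervalIntegrable, ← intervalIntegral.integral_const_mul]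
    apply intervalIntegral.integral_congr
    intro z hz
    rw [Set.uIcc_of_le zero_le_one] at hz
    change f z * g₀ z = _
    rw [hEL z hz]
    ring
  have hg0c : ContinuousOn g₀ (Set.uIcc 0 1) := by
    have hT := (hE₀.intervalIntegrable.absolutelyContinuousOnInterval_intervalIntegral
      (c := 1) (by simp)).continuousOn
    refine (hT.const_mul K).congr fun z hz => ?_
    rw [Set.uIcc_of_le zero_le_one] at hz
    rw [hEL z hz, intervalIntegral.integral_symm]
    ring
  have hgg₀ : IntervalIntegrable (fun z => g z * g₀ z) volume 0 1 := hg.mul_continuousOn hg0c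
  have hexp : ∫ z in (0:ℝ)..1, (exp (2 * F₀ z) + 2 * (F z * exp (2 * F₀ z))
      - 2 * (F₀ z * exp (2 * F₀ z))) ≤ ∫ z in (0:ℝ)..1, exp (2 * F z) := by
    apply intervalIntegral.integral_mono_on zero_le_one
    · exact ContinuousOn.intervalIntegrable (by fun_prop)
    · exact hE.intervalIntegrable
    · intro z _
      have h := mul_le_mul_of_nonneg_left (add_one_le_exp (2 * F z - 2 * F₀ z))
        (exp_pos (2 * F₀ z)).le
      rw [← exp_add, add_sub_cancel] at h
      linarith
  rw [intervalIntegral.integral_sub, intervalIntegral.integral_add,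
    intervalIntegral.integral_const_mul, intervalIntegral.integral_const_mul, heq] at hexp
  rotate_left
  iterate 4 exact ContinuousOn.intervalIntegrable (by fun_prop)
  have hsq : ∫ z in (0:ℝ)..1, (2 * (g z * g₀ z) - g₀ z ^ 2) ≤ ∫ z in (0:ℝ)..1, g z ^ 2 := by
    apply intervalIntegral.integral_mono_on zero_le_one ((hgg₀.const_mul 2).sub h₂) hg2
    intro z _
    nlinarith [sq_nonneg (g z - g₀ z)]
  rw [intervalIntegral.integral_sub (hgg₀.const_mul 2) h₂,
    intervalIntegral.integral_const_mul, hpair g hg] at hsq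
  have h00 : ∫ z in (0:ℝ)..1, g₀ z ^ 2 =
      -K * ∫ z in (0:ℝ)..1, F₀ z * exp (2 * F₀ z) := by
    rw [← hpair g₀ h₁]
    simp_rw [sq]
  have := mul_le_mul_of_nonneg_left
    (show ∫ z in (0:ℝ)..1, F z * exp (2 * F₀ z) ≤ ∫ z in (0:ℝ)..1, F₀ z * exp (2 * F₀ z) by
      linarith) hK
  change _ * (_ * ∫ z in (0:ℝ)..1, F z * exp (2 * F₀ z)) - _ ≤ _ at hsq
  linarith

lemma hasDerivAt_tanh (x : ℝ) : HasDerivAt tanh (1 / cosh x ^ 2) x := by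
  have h := (hasDerivAt_sinh x).div (hasDerivAt_cosh x) (cosh_pos x).ne'
  rw [show tanh = sinh / cosh from funext tanh_eq_sinh_div_cosh]
  convert! h using 1
  rw [← sq, ← sq, cosh_sq]; ring

lemma log_one_add_tanh_and_log_one_sub_tanh (a : ℝ) :
    log (1 + tanh a) = a - log (cosh a) ∧ log (1 - tanh a) = -a - log (cosh a) := by
  have hc := cosh_pos a
  have h1 : 1 + tanh a = exp a / cosh a := by
    rw [tanh_eq_sinh_div_cosh, ← cosh_add_sinh]; field_simp
  have h2 : 1 - tanh a = exp (-a) / cosh a := by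
    rw [tanh_eq_sinh_div_cosh, ← cosh_sub_sinh]; field_simp
  rw [h1, h2, log_div (exp_pos _).ne' hc.ne', log_div (exp_pos _).ne' hc.ne', log_exp, log_exp]
  simp

lemma mul_log_add_sub_le_mul_log {x s : ℝ} (hx : 0 < x) (hs : 0 < s) :
    x * log s + x - s ≤ x * log x := by
  have h := mul_le_mul_of_nonneg_left (log_le_sub_one_of_pos (div_pos hs hx)) hx.le
  rw [log_div hs.ne' hx.ne', mul_sub, mul_sub, mul_div_cancel₀ _ hx.ne'] at h
  linarith

lemma hasDerivAt_integral_tail {ρ : ℝ → ℝ} (hρ : Continuous ρ) (z : ℝ) :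
    HasDerivAt (fun z => ∫ t in z..1, ρ t) (-ρ z) z :=
  intervalIntegral.integral_hasDerivAt_left (hρ.intervalIntegrable _ _)
    (hρ.stronglyMeasurableAtFilter _ _) hρ.continuousAt

lemma integral_tail_mem_Icc {ρ : ℝ → ℝ} (hρ : Continuous ρ) (hpos : ∀ z, 0 < ρ z)
    (hint : ∫ z in (0:ℝ)..1, ρ z = 1) {z : ℝ} (hz : z ∈ Set.Icc (0:ℝ) 1) :
    ∫ t in z..1, ρ t ∈ Set.Icc (0:ℝ) 1 := by
  have h := intervalIntegral.integral_add_adjacent_intervals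
    (hρ.intervalIntegrable (μ := volume) 0 z) (hρ.intervalIntegrable z 1)
  have h0 := intervalIntegral.integral_nonneg (μ := volume) hz.1 fun t _ => (hpos t).le
  have h1 := intervalIntegral.integral_nonneg (μ := volume) hz.2 fun t _ => (hpos t).le
  exact ⟨h1, by linarith⟩

lemma tanh_mul_mem_Ico {a r : ℝ} (ha : 0 < a) (hr : r ∈ Set.Icc (0:ℝ) 1) :
    tanh a * r ∈ Set.Ico (0:ℝ) 1 := by
  have ht0 : 0 < tanh a := by
    rw [tanh_eq_sinh_div_cosh]; exact div_pos (sinh_pos_iff.2 ha) (cosh_pos a)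
  have ht1 : tanh a < 1 := tanh_lt_one a
  exact ⟨mul_nonneg ht0.le hr.1, by nlinarith [hr.1, hr.2]⟩

/-- The integral is exact in the tail mass `∫ t in z..1, ρ t`, hence does not depend on `ρ`. -/
lemma integral_mul_log_tail {a c : ℝ} (ha : 0 < a) {ρ : ℝ → ℝ} (hρ : Continuous ρ)
    (hpos : ∀ z, 0 < ρ z) (hint : ∫ z in (0:ℝ)..1, ρ z = 1) :
    IntervalIntegrable (fun z => ρ z *
      (c + log (1 + tanh a * ∫ t in z..1, ρ t) + log (1 - tanh a * ∫ t in z..1, ρ t)))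
      volume 0 1 ∧
    ∫ z in (0:ℝ)..1, ρ z *
      (c + log (1 + tanh a * ∫ t in z..1, ρ t) + log (1 - tanh a * ∫ t in z..1, ρ t)) =
    c - 2 * log (cosh a) - 2 + 2 * (a / tanh a) := by
  have ht0 : 0 < tanh a := by
    rw [tanh_eq_sinh_div_cosh]; exact div_pos (sinh_pos_iff.2 ha) (cosh_pos a)
  have hRd := hasDerivAt_integral_tail hρ
  have hR0 : ∀ z ∈ Set.uIcc (0:ℝ) 1, tanh a * (∫ t in z..1, ρ t) ∈ Set.Ico (0:ℝ) 1 := by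
    intro z hz
    rw [Set.uIcc_of_le zero_le_one] at hz
    exact tanh_mul_mem_Ico ha (integral_tail_mem_Icc hρ hpos hint hz)
  have hR1 : ∫ t in (1:ℝ)..1, ρ t = 0 := intervalIntegral.integral_same
  set R : ℝ → ℝ := fun z => ∫ t in z..1, ρ t
  have hR : Continuous R := continuous_iff_continuousAt.2 fun z => (hRd z).continuousAt
  have hcont : ContinuousOn (fun z => ρ z *
      (c + log (1 + tanh a * R z) + log (1 - tanh a * R z))) (Set.uIcc 0 1) := by
    refine hρ.continuousOn.mul ((continuousOn_const.add ?_).add ?_)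
    · exact ContinuousOn.log (by fun_prop) fun z hz => by
        have := (hR0 z hz).1
        change 0 ≤ tanh a * R z at this
        positivity
    · exact ContinuousOn.log (by fun_prop) fun z hz => by
        have := (hR0 z hz).2
        change tanh a * R z < 1 at this
        linarith
  refine ⟨hcont.intervalIntegrable, ?_⟩
  have hder : ∀ z ∈ Set.uIcc (0:ℝ) 1, HasDerivAt
      (fun z => -(c * R z + (tanh a)⁻¹ * ((1 + tanh a * R z) * log (1 + tanh a * R z)
        - (1 - tanh a * R z) * log (1 - tanh a * R z)) - 2 * R z))
      (ρ z * (c + log (1 + tanh a * R z) + log (1 - tanh a * R z))) z := by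
    intro z hz
    have hp : 1 + tanh a * R z ≠ 0 := by
      have := (hR0 z hz).1
      change 0 ≤ tanh a * R z at this
      positivity
    have hm : 1 - tanh a * R z ≠ 0 := by
      have := (hR0 z hz).2
      change tanh a * R z < 1 at this
      linarith
    have d := hRd z
    have dp := ((d.const_mul (tanh a)).const_add 1)
    have dm := ((d.const_mul (tanh a)).const_sub 1)
    have h := (((d.const_mul c).add (((dp.mul (dp.log hp)).sub
      (dm.mul (dm.log hm))).const_mul (tanh a)⁻¹)).sub (d.const_mul 2)).neg
    convert! h using 1
    change _ = -(c * -ρ z + (tanh a)⁻¹ * (tanh a * -ρ z * log (1 + tanh a * R z) +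
      (1 + tanh a * R z) * (tanh a * -ρ z / (1 + tanh a * R z)) -
      (-(tanh a * -ρ z) * log (1 - tanh a * R z) +
      (1 - tanh a * R z) * (-(tanh a * -ρ z) / (1 - tanh a * R z)))) - 2 * -ρ z)
    field_simp
    ring
  have hR0' : R 0 = 1 := hint
  have hR1' : R 1 = 0 := hR1
  rw [intervalIntegral.integral_eq_sub_of_hasDerivAt hder hcont.intervalIntegrable, hR0', hR1',
    mul_one (tanh a), (log_one_add_tanh_and_log_one_sub_tanh a).1,
    (log_one_add_tanh_and_log_one_sub_tanh a).2]
  simp only [mul_zero, add_zero, sub_zero, log_one]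
  field_simp
  ring

lemma sub_mul_tanh_le_integral_sq {a : ℝ} (ha : 0 < a) {g : ℝ → ℝ} (hg : Integrable g)
    (hg2 : IntervalIntegrable (fun z => g z ^ 2) volume 0 1)
    (hgu : ∫ z in (0:ℝ)..1, exp (2 * ∫ t in (0:ℝ)..z, g t) = sinh (2 * a) / (2 * a)) :
    a ^ 2 - a * tanh a ≤ ∫ z in (0:ℝ)..1, g z ^ 2 := by
  have hc := cosh_pos a
  have hsh : 0 < sinh a := sinh_pos_iff.2 ha
  set u := sinh (2 * a) / (2 * a) with hu
  have hu0 : 0 < u := div_pos (sinh_pos_iff.2 (by linarith)) (by linarith)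
  have ht0 : 0 < tanh a := by rw [tanh_eq_sinh_div_cosh]; positivity
  have hF : Continuous fun z => ∫ t in (0:ℝ)..z, g t :=
    intervalIntegral.continuous_primitive (fun _ _ => hg.intervalIntegrable) 0
  set F : ℝ → ℝ := fun z => ∫ t in (0:ℝ)..z, g t
  let ρ : ℝ → ℝ := fun z => exp (2 * F z) / u
  have hρ : Continuous ρ := by fun_prop
  have hpos : ∀ z, 0 < ρ z := fun z => div_pos (exp_pos _) hu0
  have hint : ∫ z in (0:ℝ)..1, ρ z = 1 := by
    rw [intervalIntegral.integral_div, hgu, div_self hu0.ne']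
  obtain ⟨hi, hfeed⟩ :=
    integral_mul_log_tail (c := log u + log (a / tanh a) + 1) ha hρ hpos hint
  have hparts := integral_mul_tail_eq hg.intervalIntegrable (hρ.intervalIntegrable 0 1)
  have hmem := fun z hz => integral_tail_mem_Icc hρ hpos hint (z := z) hz
  have hR : Continuous fun z => ∫ t in z..1, ρ t :=
    continuous_iff_continuousAt.2 fun z => (hasDerivAt_integral_tail hρ z).continuousAt
  set R : ℝ → ℝ := fun z => ∫ t in z..1, ρ t
  have hgR : IntervalIntegrable (fun z => g z * R z) volume 0 1 :=
    hg.intervalIntegrable.mul_continuousOn hR.continuousOn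
  have hRR : IntervalIntegrable (fun z => (a * tanh a) ^ 2 * R z ^ 2) volume 0 1 :=
    Continuous.intervalIntegrable (by fun_prop) _ _
  have hFρ : IntervalIntegrable (fun z => F z * ρ z) volume 0 1 :=
    Continuous.intervalIntegrable (by fun_prop) _ _
  have h1 : ∫ z in (0:ℝ)..1, (2 * (a * tanh a) * (g z * R z) - (a * tanh a) ^ 2 * R z ^ 2) ≤
      ∫ z in (0:ℝ)..1, g z ^ 2 := by
    apply intervalIntegral.integral_mono_on zero_le_one ((hgR.const_mul _).sub hRR) hg2
    intro z _
    nlinarith [sq_nonneg (g z - a * tanh a * R z)]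
  have h2 : ∫ z in (0:ℝ)..1, a * tanh a * (ρ z * (log u + log (a / tanh a) + 1 +
      log (1 + tanh a * R z) + log (1 - tanh a * R z)) - a / tanh a) ≤
      ∫ z in (0:ℝ)..1, (2 * (a * tanh a) * (F z * ρ z) - (a * tanh a) ^ 2 * R z ^ 2) := by
    apply intervalIntegral.integral_mono_on zero_le_one
      ((hi.sub intervalIntegrable_const).const_mul _) ((hFρ.const_mul _).sub hRR)
    intro z hz
    obtain ⟨hr0, hr1⟩ := tanh_mul_mem_Ico ha (hmem z hz)
    change 0 ≤ tanh a * R z at hr0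
    change tanh a * R z < 1 at hr1
    have hp : 0 < 1 + tanh a * R z := by linarith
    have hm : 0 < 1 - tanh a * R z := by linarith
    have hq : 0 < a / tanh a := div_pos ha ht0
    have hlog := mul_log_add_sub_le_mul_log (hpos z) (mul_pos (mul_pos hq hp) hm)
    have hlρ : log (ρ z) = 2 * F z - log u := by
      rw [log_div (exp_pos _).ne' hu0.ne', log_exp]
    rw [log_mul (mul_pos hq hp).ne' hm.ne', log_mul hq.ne' hp.ne', hlρ] at hlog
    have hid : a / tanh a * (1 + tanh a * R z) * (1 - tanh a * R z) =
        a / tanh a - a * tanh a * R z ^ 2 := by field_simp; ring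
    rw [hid] at hlog
    have := mul_le_mul_of_nonneg_left hlog (mul_pos ha ht0).le
    nlinarith [this]
  rw [intervalIntegral.integral_sub (hgR.const_mul _) hRR,
    intervalIntegral.integral_const_mul] at h1
  rw [intervalIntegral.integral_sub (hFρ.const_mul _) hRR,
    intervalIntegral.integral_const_mul, intervalIntegral.integral_const_mul,
    intervalIntegral.integral_sub hi intervalIntegrable_const] at h2
  change ∫ z in (0:ℝ)..1, g z * R z = ∫ z in (0:ℝ)..1, F z * ρ z at hparts
  change ∫ z in (0:ℝ)..1, ρ z * (log u + log (a / tanh a) + 1 +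
      log (1 + tanh a * R z) + log (1 - tanh a * R z)) = _ at hfeed
  rw [hfeed, intervalIntegral.integral_const] at h2
  have hlogs : log u + log (a / tanh a) - 2 * log (cosh a) = 0 := by
    have hprod : u * (a / tanh a) = cosh a ^ 2 := by
      rw [hu, sinh_two_mul, tanh_eq_sinh_div_cosh]
      field_simp
    rw [← log_mul hu0.ne' (div_pos ha ht0).ne', hprod, log_pow]
    simp
  have hfin : a * tanh a * (a / tanh a - 1) = a ^ 2 - a * tanh a := by field_simp
  rw [← hfin]
  refine le_trans (le_of_eq ?_) (h2.trans (hparts ▸ h1))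
  congr 1
  simp only [sub_zero, smul_eq_mul, one_mul]
  linarith

lemma exists_sinh_div_self_eq {u : ℝ} (hu : 1 < u) : ∃ ξ : ℝ, 0 < ξ ∧ sinh ξ / ξ = u := by
  have hx : 0 < arcosh u := arcosh_pos hu
  have hlow : sinh (arcosh u) - u * arcosh u ≤ 0 := by
    have hmono : MonotoneOn (fun x => x * cosh x - sinh x) (Set.Ici 0) := by
      apply monotoneOn_of_deriv_nonneg (convex_Ici 0) (by fun_prop) (by fun_prop)
      intro x hx
      rw [interior_Ici] at hx
      have h := ((hasDerivAt_id x).mul (hasDerivAt_cosh x)).sub (hasDerivAt_sinh x)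
      have he : deriv (fun x => x * cosh x - sinh x) x = x * sinh x := by
        refine Eq.trans h.deriv ?_
        simp
      rw [he]
      exact mul_nonneg (le_of_lt hx) (sinh_nonneg_iff.2 (le_of_lt hx))
    have := hmono (Set.mem_Ici.2 le_rfl) (Set.mem_Ici.2 hx.le) hx.le
    simp only [zero_mul, sinh_zero, sub_zero, cosh_arcosh hu.le] at this
    linarith
  have hhigh : 0 ≤ sinh (arcosh u + 4 * u) - u * (arcosh u + 4 * u) := by
    set y := arcosh u + 4 * u with hy
    have h1 := quadratic_le_exp_of_nonneg (show 0 ≤ y by linarith)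
    have h2 : exp (-y) ≤ 1 := exp_le_one_iff.2 (by linarith)
    rw [sinh_eq]
    nlinarith
  obtain ⟨ξ, hξ, h0⟩ := intermediate_value_Icc (show arcosh u ≤ arcosh u + 4 * u by linarith)
    (f := fun x => sinh x - u * x) (by fun_prop) ⟨hlow, hhigh⟩
  have hpos : 0 < ξ := hx.trans_le hξ.1
  exact ⟨ξ, hpos, by rw [div_eq_iff hpos.ne']; exact sub_eq_zero.1 h0⟩

lemma exists_sin_div_self_eq {u : ℝ} (hu0 : 0 < u) (hu1 : u < 1) :
    ∃ l ∈ Set.Ioo 0 (π / 2), sin (2 * l) / (2 * l) = u := by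
  have hx0 : 0 < arccos u := arccos_pos.2 hu1
  have hx1 : arccos u < π / 2 := arccos_lt_pi_div_two.2 hu0
  have hcos : cos (arccos u) = u := cos_arccos (by linarith) hu1.le
  have hlow : 0 ≤ sin (arccos u) - u * arccos u := by
    have h := lt_tan hx0 hx1
    rw [tan_eq_sin_div_cos, hcos, lt_div_iff₀ hu0] at h
    linarith
  have hhigh : sin π - u * π ≤ 0 := by
    have := mul_pos hu0 pi_pos
    simp [this.le]
  obtain ⟨x, hx, h0⟩ := intermediate_value_Icc' (show arccos u ≤ π by linarith [pi_pos])
    (f := fun x => sin x - u * x) (by fun_prop) ⟨hhigh, hlow⟩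
  have hpos : 0 < x := hx0.trans_le hx.1
  have hne : x ≠ π := by
    rintro rfl
    have : sin π - u * π = 0 := h0
    rw [sin_pi] at this
    have := mul_pos hu0 pi_pos
    linarith
  refine ⟨x / 2, ⟨by linarith, by linarith [lt_of_le_of_ne hx.2 hne]⟩, ?_⟩
  rw [mul_div_cancel₀ _ two_ne_zero, div_eq_iff hpos.ne']
  exact sub_eq_zero.1 h0

lemma sInf_ratefun_of_one_lt {a : ℝ} (ha : 0 < a) :
    sInf {r : ℝ | ∃ v : ℝ, 0 < v ∧ r = ratefun (sinh (2 * a) / (2 * a)) v} =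
      4 * (a ^ 2 - a * tanh a) := by
  have hlin : ∀ z : ℝ, HasDerivAt (fun z => a * (1 - z)) (-a) z := fun z => by
    simpa using ((hasDerivAt_id z).const_sub 1).const_mul a
  have hth : ∀ z : ℝ, HasDerivAt (fun z => tanh (a * (1 - z)))
      (1 / cosh (a * (1 - z)) ^ 2 * -a) z := fun z =>
    HasDerivAt.comp (h₂ := tanh) z (hasDerivAt_tanh _) (hlin z)
  have hcont : Continuous fun z => a * tanh (a * (1 - z)) :=
    continuous_const.mul (continuous_iff_continuousAt.2 fun z => (hth z).continuousAt)
  have hprim : ∀ z : ℝ, ∫ t in (0:ℝ)..z, a * tanh (a * (1 - t)) =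
      log (cosh a) - log (cosh (a * (1 - z))) := by
    intro z
    have hd : ∀ x ∈ Set.uIcc 0 z, HasDerivAt (fun z => -log (cosh (a * (1 - z))))
        (a * tanh (a * (1 - x))) x := by
      intro x _
      have h := ((hlin x).cosh.log (cosh_pos _).ne').neg
      convert! h using 1
      rw [tanh_eq_sinh_div_cosh]
      ring
    rw [intervalIntegral.integral_eq_sub_of_hasDerivAt hd (hcont.intervalIntegrable _ _)]
    simp
    ring
  have hexp : ∀ z : ℝ, exp (2 * ∫ t in (0:ℝ)..z, a * tanh (a * (1 - t))) =
      cosh a ^ 2 / cosh (a * (1 - z)) ^ 2 := by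
    intro z
    rw [hprim, two_mul, exp_add, exp_sub, exp_log (cosh_pos _), exp_log (cosh_pos _)]
    ring
  have hu : ∫ z in (0:ℝ)..1, exp (2 * ∫ t in (0:ℝ)..z, a * tanh (a * (1 - t))) =
      sinh (2 * a) / (2 * a) := by
    simp_rw [hexp]
    have hd : ∀ x ∈ Set.uIcc (0:ℝ) 1, HasDerivAt
        (fun z => -(cosh a ^ 2 / a) * tanh (a * (1 - z)))
        (cosh a ^ 2 / cosh (a * (1 - x)) ^ 2) x := by
      intro x _
      convert! (hth x).const_mul (-(cosh a ^ 2 / a)) using 1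
      field_simp
    rw [intervalIntegral.integral_eq_sub_of_hasDerivAt hd]
    · have := (cosh_pos a).ne'
      rw [sinh_two_mul]
      simp [tanh_eq_sinh_div_cosh]
      field_simp
    · exact Continuous.intervalIntegrable (continuous_const.div (by fun_prop)
        fun z => pow_ne_zero 2 (cosh_pos _).ne') _ _
  have henergy : ∫ z in (0:ℝ)..1, (a * tanh (a * (1 - z))) ^ 2 = a ^ 2 - a * tanh a := by
    have hd : ∀ x ∈ Set.uIcc (0:ℝ) 1, HasDerivAt
        (fun z => a ^ 2 * z + a * tanh (a * (1 - z))) ((a * tanh (a * (1 - x))) ^ 2) x := by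
      intro x _
      convert! ((hasDerivAt_id x).const_mul (a ^ 2)).add ((hth x).const_mul a) using 1
      rw [tanh_eq_sinh_div_cosh]
      have := (cosh_pos (a * (1 - x))).ne'
      field_simp
      rw [cosh_sq]
      ring
    rw [intervalIntegral.integral_eq_sub_of_hasDerivAt hd
      ((hcont.pow 2).intervalIntegrable _ _)]
    simp
  have hu0 : 0 < sinh (2 * a) / (2 * a) :=
    div_pos (sinh_pos_iff.2 (by linarith)) (by linarith)
  rw [sInf_ratefun_eq hu0 (hcont.intervalIntegrable 0 1)
    ((hcont.pow 2).intervalIntegrable 0 1) hu, henergy]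
  intro g hg hg2 hgu
  rw [henergy]
  have hae : ∀ᵐ t, ∀ z ∈ Set.Icc (0:ℝ) 1, t ∈ Set.uIoc 0 z →
      (Set.Ioc (0:ℝ) 1).indicator g t = g t := by
    refine Eventually.of_forall fun t z hz ht => ?_
    rw [Set.uIoc_of_le hz.1] at ht
    exact Set.indicator_of_mem (Set.mem_Ioc.2 ⟨ht.1, ht.2.trans hz.2⟩) g
  have hint : Integrable ((Set.Ioc (0:ℝ) 1).indicator g) :=
    (integrable_indicator_iff measurableSet_Ioc).2
      ((intervalIntegrable_iff_integrableOn_Ioc_of_le zero_le_one).1 hg)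
  have hcongr : ∀ z ∈ Set.Icc (0:ℝ) 1,
      ∫ t in (0:ℝ)..z, (Set.Ioc (0:ℝ) 1).indicator g t = ∫ t in (0:ℝ)..z, g t := fun z hz =>
    intervalIntegral.integral_congr_ae (hae.mono fun t ht => ht z hz)
  have hsq : ∀ t ∈ Set.uIoc (0:ℝ) 1, (Set.Ioc (0:ℝ) 1).indicator g t ^ 2 = g t ^ 2 := by
    intro t ht
    rw [Set.uIoc_of_le zero_le_one] at ht
    rw [Set.indicator_of_mem ht]
  rw [← intervalIntegral.integral_congr_ae (Eventually.of_forall hsq)]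
  refine sub_mul_tanh_le_integral_sq ha hint ?_ ?_
  · exact hg2.congr fun t ht => (hsq t ht).symm
  · rw [← hgu]
    apply intervalIntegral.integral_congr
    intro z hz
    rw [Set.uIcc_of_le zero_le_one] at hz
    simp only [hcongr z hz]

lemma sInf_ratefun_of_lt_one {l : ℝ} (hl : l ∈ Set.Ioo 0 (π / 2)) :
    sInf {r : ℝ | ∃ v : ℝ, 0 < v ∧ r = ratefun (sin (2 * l) / (2 * l)) v} =
      4 * (l * tan l - l ^ 2) := by
  obtain ⟨hl0, hl1⟩ := hl
  have hcl : 0 < cos l := cos_pos_of_mem_Ioo ⟨by linarith, hl1⟩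
  have hcos : ∀ z ∈ Set.Icc (0:ℝ) 1, 0 < cos (l * (1 - z)) := by
    rintro z ⟨h0, h1⟩
    exact cos_pos_of_mem_Ioo ⟨by nlinarith, by nlinarith⟩
  have hlin : ∀ z : ℝ, HasDerivAt (fun z => l * (1 - z)) (-l) z := fun z => by
    simpa using ((hasDerivAt_id z).const_sub 1).const_mul l
  have hta : ∀ z ∈ Set.Icc (0:ℝ) 1, HasDerivAt (fun z => tan (l * (1 - z)))
      (1 / cos (l * (1 - z)) ^ 2 * -l) z := fun z hz =>
    HasDerivAt.comp (h₂ := tan) z (hasDerivAt_tan (hcos z hz).ne') (hlin z)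
  have hcont : ContinuousOn (fun z => -l * tan (l * (1 - z))) (Set.Icc 0 1) :=
    continuousOn_const.mul fun z hz => (hta z hz).continuousAt.continuousWithinAt
  have hcont' : ContinuousOn (fun z => cos l ^ 2 / cos (l * (1 - z)) ^ 2) (Set.Icc 0 1) :=
    continuousOn_const.div (by fun_prop) fun z hz => pow_ne_zero 2 (hcos z hz).ne'
  have hprim : ∀ z ∈ Set.Icc (0:ℝ) 1, ∫ t in (0:ℝ)..z, -l * tan (l * (1 - t)) =
      log (cos l) - log (cos (l * (1 - z))) := by
    intro z hz
    have hsub : Set.uIcc 0 z ⊆ Set.Icc 0 1 := by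
      rw [Set.uIcc_of_le hz.1]
      exact Set.Icc_subset_Icc_right hz.2
    have hd : ∀ x ∈ Set.uIcc 0 z, HasDerivAt (fun z => -log (cos (l * (1 - z))))
        (-l * tan (l * (1 - x))) x := by
      intro x hx
      have h := ((hlin x).cos.log (hcos x (hsub hx)).ne').neg
      convert! h using 1
      rw [tan_eq_sin_div_cos]
      ring
    rw [intervalIntegral.integral_eq_sub_of_hasDerivAt hd (hcont.mono hsub).intervalIntegrable]
    simp
    ring
  have hexp : ∀ z ∈ Set.Icc (0:ℝ) 1, exp (2 * ∫ t in (0:ℝ)..z, -l * tan (l * (1 - t))) =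
      cos l ^ 2 / cos (l * (1 - z)) ^ 2 := by
    intro z hz
    rw [hprim z hz, two_mul, exp_add, exp_sub, exp_log hcl, exp_log (hcos z hz)]
    ring
  have htail : ∀ z ∈ Set.Icc (0:ℝ) 1,
      ∫ y in z..1, exp (2 * ∫ t in (0:ℝ)..y, -l * tan (l * (1 - t))) =
      cos l ^ 2 / l * tan (l * (1 - z)) := by
    intro z hz
    have hsub : Set.uIcc z 1 ⊆ Set.Icc 0 1 := by
      rw [Set.uIcc_of_le hz.2]
      exact Set.Icc_subset_Icc_left hz.1
    rw [intervalIntegral.integral_congr fun y hy => hexp y (hsub hy)]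
    have hd : ∀ x ∈ Set.uIcc z 1, HasDerivAt
        (fun z => -(cos l ^ 2 / l) * tan (l * (1 - z)))
        (cos l ^ 2 / cos (l * (1 - x)) ^ 2) x := by
      intro x hx
      convert! (hta x (hsub hx)).const_mul (-(cos l ^ 2 / l)) using 1
      field_simp
    rw [intervalIntegral.integral_eq_sub_of_hasDerivAt hd (hcont'.mono hsub).intervalIntegrable]
    simp
  have hu : ∫ z in (0:ℝ)..1, exp (2 * ∫ t in (0:ℝ)..z, -l * tan (l * (1 - t))) =
      sin (2 * l) / (2 * l) := by
    rw [htail 0 (by simp), sin_two_mul, sub_zero, mul_one, tan_eq_sin_div_cos]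
    field_simp
  have huIcc : Set.uIcc (0:ℝ) 1 = Set.Icc 0 1 := Set.uIcc_of_le zero_le_one
  have hi : IntervalIntegrable (fun z => -l * tan (l * (1 - z))) volume 0 1 :=
    (huIcc ▸ hcont).intervalIntegrable
  have hi2 : IntervalIntegrable (fun z => (-l * tan (l * (1 - z))) ^ 2) volume 0 1 :=
    (huIcc ▸ hcont.pow 2).intervalIntegrable
  have henergy : ∫ z in (0:ℝ)..1, (-l * tan (l * (1 - z))) ^ 2 = l * tan l - l ^ 2 := by
    have hd : ∀ x ∈ Set.uIcc (0:ℝ) 1, HasDerivAt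
        (fun z => -l ^ 2 * z - l * tan (l * (1 - z))) ((-l * tan (l * (1 - x))) ^ 2) x := by
      intro x hx
      rw [huIcc] at hx
      convert! ((hasDerivAt_id x).const_mul (-l ^ 2)).sub ((hta x hx).const_mul l) using 1
      rw [tan_eq_sin_div_cos]
      have := (hcos x hx).ne'
      field_simp
      rw [sin_sq]
      ring
    rw [intervalIntegral.integral_eq_sub_of_hasDerivAt hd hi2]
    simp
    ring
  have hu0 : 0 < sin (2 * l) / (2 * l) :=
    div_pos (sin_pos_of_pos_of_lt_pi (by linarith) (by linarith)) (by linarith)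
  rw [sInf_ratefun_eq hu0 hi hi2 hu, henergy]
  intro g hg hg2 hgu
  refine integral_sq_le_of_euler_lagrange (K := l ^ 2 / cos l ^ 2) (by positivity) hi hi2 ?_ hg hg2
    (hgu.trans hu.symm)
  intro z hz
  rw [htail z hz]
  field_simp

lemma sInf_ratefun_one : sInf {r : ℝ | ∃ v : ℝ, 0 < v ∧ r = ratefun 1 v} = 0 := by
  rw [sInf_ratefun_eq one_pos (g₀ := fun _ => 0) (by simp) (by simp) (by simp)]
  · simp
  · intro g _ _ _
    simpa using intervalIntegral.integral_nonneg (μ := volume) zero_le_one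
      fun z _ => sq_nonneg (g z)

/-- One-dimensional projection: for every `u > 0`, `inf_{v>0} I(u,v) = 2 J_BS(u)`, with `J_BS`
given explicitly through the unique solutions `ξ` (for `u > 1`) and `λ` (for `0 < u < 1`) of the
indicated equations, and `J_BS(1) = 0`. -/
theorem ratefun_proj_u (u : ℝ) (hu : 0 < u)
    (JBS : ℝ → ℝ)
    (hJ_gt : ∀ x : ℝ, 1 < x → ∀ ξ : ℝ, 0 < ξ → Real.sinh ξ / ξ = x →
      JBS x = ξ ^ 2 / 2 - ξ * Real.tanh (ξ / 2))
    (hJ_lt : ∀ x : ℝ, 0 < x → x < 1 → ∀ lam : ℝ, lam ∈ Set.Ioo 0 (Real.pi / 2) →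
      Real.sin (2 * lam) / (2 * lam) = x → JBS x = 2 * lam * (Real.tan lam - lam))
    (hJ_one : JBS 1 = 0) :
    sInf {r : ℝ | ∃ v : ℝ, 0 < v ∧ r = ratefun u v} = 2 * JBS u := by
  rcases lt_trichotomy u 1 with h | rfl | h
  · obtain ⟨l, hl, hlu⟩ := exists_sin_div_self_eq hu h
    rw [hJ_lt u hu h l hl hlu, ← hlu, sInf_ratefun_of_lt_one hl]
    ring
  · rw [hJ_one, sInf_ratefun_one, mul_zero]
  · obtain ⟨ξ, hξ, hξu⟩ := exists_sinh_div_self_eq h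
    have hinf := sInf_ratefun_of_one_lt (half_pos hξ)
    rw [mul_div_cancel₀ _ two_ne_zero, hξu] at hinf
    rw [hJ_gt u h ξ hξ hξu, hinf]
    ring
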